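/- Let a₁,…,a₅ ∈ ℂ and let S = P − U_{a₁,…,a₅}. Suppose that S(1, i, 0, 0) ≠ 0 and that every singular point of the surface {S = 0} in ℙ³(ℂ) lying in the plane {y = 0} is a node. Then every singular point of {S = 0} is a node. Moreover, if the plane septic curve S(x,0,z,w) = 0 in ℙ²(ℂ) has exactly n singular points, all nodes, of which exactly n_{xy} satisfy x = 0, then the surface {S = 0} has exactly n_{xy} + 7·(n − n_{xy}) singular points in ℙ³(ℂ), all of them nodes. -/

import Mathlib

open MvPolynomial

/-- The septic `P(x,y,z,w)` (variables `X 0 = x, X 1 = y, X 2 = z, X 3 = w`). -/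
noncomputable def Psept : MvPolynomial (Fin 4) ℂ :=
  X 0 * ((X 0) ^ 6 - 21 * (X 0) ^ 4 * (X 1) ^ 2 + 35 * (X 0) ^ 2 * (X 1) ^ 4
      - 7 * (X 1) ^ 6)
    + 7 * X 2 * (((X 0) ^ 2 + (X 1) ^ 2) ^ 3
        - 8 * (X 2) ^ 2 * ((X 0) ^ 2 + (X 1) ^ 2) ^ 2
        + 16 * (X 2) ^ 4 * ((X 0) ^ 2 + (X 1) ^ 2))
    - 64 * (X 2) ^ 7

/-- `U_{a₁,…,a₅}(x,y,z,w) = (z + a₅w)(a₁z³ + a₂z²w + a₃zw² + a₄w³ + (z+w)(x²+y²))²`. -/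
noncomputable def Usept (a₁ a₂ a₃ a₄ a₅ : ℂ) : MvPolynomial (Fin 4) ℂ :=
  (X 2 + C a₅ * X 3) *
    (C a₁ * (X 2) ^ 3 + C a₂ * (X 2) ^ 2 * X 3 + C a₃ * X 2 * (X 3) ^ 2
        + C a₄ * (X 3) ^ 3 + (X 2 + X 3) * ((X 0) ^ 2 + (X 1) ^ 2)) ^ 2

/-- All partial derivatives of `F` vanish at `v`. -/
def VanishingJacobianAt {n : ℕ} (F : MvPolynomial (Fin n) ℂ) (v : Fin n → ℂ) : Prop :=
  ∀ i, eval v (pderiv i F) = 0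

/-- The Hessian matrix `(∂²F/∂xᵢ∂xⱼ)(v)`. -/
noncomputable def hessianAt {n : ℕ} (F : MvPolynomial (Fin n) ℂ) (v : Fin n → ℂ) :
    Matrix (Fin n) (Fin n) ℂ :=
  Matrix.of fun i j => eval v (pderiv i (pderiv j F))

/-- A point of ℙ^(n-1)(ℂ) is a singular point of `{F = 0}` if it is represented
by a nonzero vector at which all partial derivatives of `F` vanish. -/
def IsSingularPoint {n : ℕ} (F : MvPolynomial (Fin n) ℂ)
    (p : Projectivization ℂ (Fin n → ℂ)) : Prop :=
  ∃ v : Fin n → ℂ, ∃ hv : v ≠ 0, Projectivization.mk ℂ v hv = p ∧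
    VanishingJacobianAt F v

/-- A point is a node of `{F = 0}` if it is represented by a nonzero vector at
which all partial derivatives of `F` vanish and the Hessian matrix has rank `r`
(`r = 3` for surfaces in ℙ³, `r = 2` for plane curves in ℙ²). -/
def IsNodeOfCorank {n : ℕ} (F : MvPolynomial (Fin n) ℂ) (r : ℕ)
    (p : Projectivization ℂ (Fin n → ℂ)) : Prop :=
  ∃ v : Fin n → ℂ, ∃ hv : v ≠ 0, Projectivization.mk ℂ v hv = p ∧
    VanishingJacobianAt F v ∧ (hessianAt F v).rank = r

/-- A point of ℙ³(ℂ) lies in the plane `{y = 0}`. -/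
def LiesInPlaneY0 (p : Projectivization ℂ (Fin 4 → ℂ)) : Prop :=
  ∃ v : Fin 4 → ℂ, ∃ hv : v ≠ 0, Projectivization.mk ℂ v hv = p ∧ v 1 = 0

/-- A point of ℙ²(ℂ) (coordinates x, z, w) lies on the axis `{x = 0}`. -/
def LiesOnAxisX0 (q : Projectivization ℂ (Fin 3 → ℂ)) : Prop :=
  ∃ v : Fin 3 → ℂ, ∃ hv : v ≠ 0, Projectivization.mk ℂ v hv = q ∧ v 0 = 0


open Matrix
lemma eval_smul_hom {n d : ℕ} {F : MvPolynomial (Fin n) ℂ} (h : F.IsHomogeneous d)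
    (c : ℂ) (v : Fin n → ℂ) : eval (c • v) F = c ^ d * eval v F := by
  rw [eval_eq', eval_eq', Finset.mul_sum]
  refine Finset.sum_congr rfl fun m hm => ?_
  have hd := h.degree_eq_sum_deg_support hm
  simp only [Pi.smul_apply, smul_eq_mul, mul_pow, Finset.prod_mul_distrib]
  rw [Finset.prod_pow_eq_pow_sum]
  have : ∑ i, m i = d := by
    rw [hd]
    exact (Finset.sum_subset (Finset.subset_univ _) (by simp)).symm
  rw [this]; ring

lemma jac_smul {n d : ℕ} {F : MvPolynomial (Fin n) ℂ} (h : F.IsHomogeneous d)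
    (c : ℂ) (v : Fin n → ℂ) (hv : VanishingJacobianAt F v) : VanishingJacobianAt F (c • v) := by
  intro i
  rw [eval_smul_hom h.pderiv, hv i, mul_zero]

lemma hess_smul {n d : ℕ} {F : MvPolynomial (Fin n) ℂ} (h : F.IsHomogeneous d)
    (c : ℂ) (v : Fin n → ℂ) : hessianAt F (c • v) = c ^ (d - 1 - 1) • hessianAt F v := by
  ext i j
  simp only [hessianAt, Matrix.of_apply, Matrix.smul_apply, smul_eq_mul]
  rw [eval_smul_hom h.pderiv.pderiv]

lemma rank_smul_ne {n : ℕ} (A : Matrix (Fin n) (Fin n) ℂ) {c : ℂ} (hc : c ≠ 0) :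
    (c • A).rank = A.rank := by
  have : c • A = (c • (1 : Matrix (Fin n) (Fin n) ℂ)) * A := by simp
  rw [this]
  apply Matrix.rank_mul_eq_right_of_isUnit_det
  simp [hc]

lemma sing_mk {n d : ℕ} {F : MvPolynomial (Fin n) ℂ} (h : F.IsHomogeneous d)
    (v : Fin n → ℂ) (hv : v ≠ 0) :
    IsSingularPoint F (Projectivization.mk ℂ v hv) ↔ VanishingJacobianAt F v := by
  constructor
  · rintro ⟨w, hw, he, hj⟩
    obtain ⟨c, hc⟩ := (Projectivization.mk_eq_mk_iff' ℂ v w hv hw).1 he.symm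
    rw [← hc]; exact jac_smul h c w hj
  · exact fun hj => ⟨v, hv, rfl, hj⟩

lemma node_mk {n d r : ℕ} {F : MvPolynomial (Fin n) ℂ} (h : F.IsHomogeneous d)
    (v : Fin n → ℂ) (hv : v ≠ 0) :
    IsNodeOfCorank F r (Projectivization.mk ℂ v hv) ↔
      VanishingJacobianAt F v ∧ (hessianAt F v).rank = r := by
  constructor
  · rintro ⟨w, hw, he, hj, hr⟩
    obtain ⟨c, hc⟩ := (Projectivization.mk_eq_mk_iff' ℂ v w hv hw).1 he.symm
    have hc0 : c ≠ 0 := by rintro rfl; simp at hc; exact hv hc.symm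
    rw [← hc]; refine ⟨jac_smul h c w hj, ?_⟩
    rw [hess_smul h, rank_smul_ne _ (pow_ne_zero _ hc0), hr]
  · exact fun hj => ⟨v, hv, rfl, hj⟩

lemma pderiv_aeval {m n : ℕ} (g : Fin m → MvPolynomial (Fin n) ℂ)
    (F : MvPolynomial (Fin m) ℂ) (i : Fin n) :
    pderiv i (aeval g F) = ∑ j, aeval g (pderiv j F) * pderiv i (g j) := by
  induction F using MvPolynomial.induction_on with
  | C a => simp [algebraMap_eq]
  | add p q hp hq => simp only [map_add, hp, hq, add_mul, Finset.sum_add_distrib]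
  | mul_X p k hp =>
    simp only [map_mul, aeval_X, Derivation.leibniz, smul_eq_mul, hp, map_add, add_mul,
      Finset.sum_add_distrib, pderiv_X, Finset.mul_sum]
    congr 1
    · rw [Finset.sum_eq_single k]
      · simp
      · intro b _ hb; simp [hb.symm]
      · simp
    · exact Finset.sum_congr rfl fun j _ => by ring

lemma euler_hess {n d : ℕ} {F : MvPolynomial (Fin n) ℂ} (h : F.IsHomogeneous d)
    (v : Fin n → ℂ) (hv : VanishingJacobianAt F v) : (hessianAt F v)ᵀ.mulVec v = 0 := by
  ext j
  have h1 := congrArg (eval v) ((h.pderiv (i := j)).sum_X_mul_pderiv)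
  simp only [map_sum, map_mul, eval_X, nsmul_eq_mul, hv j, mul_zero] at h1
  simp only [Matrix.mulVec, dotProduct, hessianAt, Matrix.transpose_apply, Matrix.of_apply,
    Pi.zero_apply]
  rw [← h1]
  exact Finset.sum_congr rfl fun i _ => mul_comm _ _

lemma hasFDerivAt_eval {n : ℕ} (F : MvPolynomial (Fin n) ℂ) (v : Fin n → ℂ) :
    HasFDerivAt (fun u : Fin n → ℂ => eval u F)
      (∑ i, eval v (pderiv i F) • (ContinuousLinearMap.proj i : (Fin n → ℂ) →L[ℂ] ℂ)) v := by
  induction F using MvPolynomial.induction_on with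
  | C a => 
    simp only [eval_C]
    refine (hasFDerivAt_const (𝕜 := ℂ) a v).congr_fderiv (ContinuousLinearMap.ext fun u => ?_)
    simp
  | add p q hp hq =>
    simp only [map_add]
    refine (hp.add hq).congr_fderiv (ContinuousLinearMap.ext fun u => ?_)
    simp [add_mul, Finset.sum_add_distrib]
  | mul_X p k hp =>
    have := hp.mul (hasFDerivAt_apply (𝕜 := ℂ) k v)
    simp only [map_mul, eval_X]
    refine this.congr_fderiv (ContinuousLinearMap.ext fun u => ?_)
    simp only [_root_.add_apply, _root_.smul_apply,
      _root_.sum_apply, ContinuousLinearMap.proj_apply, smul_eq_mul,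
      Derivation.leibniz, pderiv_X, map_add, map_mul, eval_X, add_mul, Finset.sum_add_distrib,
      Finset.mul_sum]
    congr 1
    · rw [Finset.sum_eq_single k]
      · simp
      · intro b _ hb; simp [hb.symm]
      · simp
    · exact Finset.sum_congr rfl fun j _ => by ring

/-- The singular vectors in a standard chart with bounded coordinates form a finite set. -/
lemma finite_chart {d : ℕ} {F : MvPolynomial (Fin 3) ℂ} (h : F.IsHomogeneous d)
    (hn : ∀ q : Projectivization ℂ (Fin 3 → ℂ), IsSingularPoint F q → IsNodeOfCorank F 2 q)
    (k : Fin 3) :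
    {v : Fin 3 → ℂ | v k = 1 ∧ ‖v‖ ≤ 1 ∧ VanishingJacobianAt F v}.Finite := by
  apply IsCompact.finite
  · apply (isCompact_closedBall (0 : Fin 3 → ℂ) 1).of_isClosed_subset
    · apply IsClosed.inter
      · exact isClosed_eq (continuous_apply k) continuous_const
      · apply IsClosed.inter
        · exact isClosed_le continuous_norm continuous_const
        · have : {v : Fin 3 → ℂ | VanishingJacobianAt F v} =
              ⋂ i, {v | eval v (pderiv i F) = 0} := by
            ext v; simp [VanishingJacobianAt]
          change IsClosed {v : Fin 3 → ℂ | VanishingJacobianAt F v}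
          rw [this]
          exact isClosed_iInter fun i => isClosed_eq (MvPolynomial.continuous_eval _)
            continuous_const
    · intro v hv; simpa using hv.2.1
  · rw [isDiscrete_iff_nhdsNE]
    rintro v ⟨hvk, -, hj⟩
    have hv0 : v ≠ 0 := by rintro rfl; simp at hvk
    have hr := ((node_mk h v hv0).1 (hn _ ((sing_mk h v hv0).2 hj))).2
    have hE := euler_hess h v hj
    set L : (Fin 3 → ℂ) →L[ℂ] ((Fin 3 → ℂ) × ℂ) :=
      (ContinuousLinearMap.pi fun j => ∑ i, eval v (pderiv i (pderiv j F)) •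
        (ContinuousLinearMap.proj i : (Fin 3 → ℂ) →L[ℂ] ℂ)).prod
        (ContinuousLinearMap.proj k) with hL
    have hD : HasFDerivAt (fun u : Fin 3 → ℂ =>
        ((fun j => eval u (pderiv j F) : Fin 3 → ℂ), u k)) L v := by
      apply HasFDerivAt.prodMk
      · exact hasFDerivAt_pi.2 fun j => hasFDerivAt_eval _ v
      · exact hasFDerivAt_apply (𝕜 := ℂ) k v
    have hker : LinearMap.ker (L : (Fin 3 → ℂ) →ₗ[ℂ] ((Fin 3 → ℂ) × ℂ)) = ⊥ := by
      rw [LinearMap.ker_eq_bot']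
      intro u hu
      have hu1 : (hessianAt F v)ᵀ.mulVec u = 0 := by
        have := congrArg Prod.fst hu
        ext j
        have := congrFun this j
        simpa [hL, Matrix.mulVec, dotProduct, hessianAt] using this
      have hu2 : u k = 0 := congrArg Prod.snd hu
      have hrk : Module.finrank ℂ (LinearMap.ker (hessianAt F v)ᵀ.mulVecLin) = 1 := by
        have h1 := LinearMap.finrank_range_add_finrank_ker (hessianAt F v)ᵀ.mulVecLin
        have h2 : Module.finrank ℂ (LinearMap.range (hessianAt F v)ᵀ.mulVecLin) = 2 := by
          rw [← hr, ← Matrix.rank_transpose]; rfl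
        rw [h2] at h1
        simp at h1
        omega
      obtain ⟨c, hc⟩ := (finrank_eq_one_iff_of_nonzero' (⟨v, LinearMap.mem_ker.2 hE⟩ :
        LinearMap.ker (hessianAt F v)ᵀ.mulVecLin) (by simpa using hv0)).1 hrk
          ⟨u, LinearMap.mem_ker.2 hu1⟩
      have hc' : c • v = u := congrArg Subtype.val hc
      have : c = 0 := by
        have := congrFun hc' k
        simpa [hvk, hu2] using this
      rw [← hc', this, zero_smul]
    obtain ⟨K, -, hK⟩ := LinearMap.exists_antilipschitzWith _ hker
    have hev := hD.eventually_ne (c := ((0 : Fin 3 → ℂ), (1 : ℂ))) ⟨K, hK⟩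
    rw [← disjoint_iff, Filter.disjoint_principal_right]
    filter_upwards [hev] with u hu hu'
    apply hu
    rw [hu'.1]
    congr 1
    ext j
    exact hu'.2.2 j

lemma finite_sing {d : ℕ} {F : MvPolynomial (Fin 3) ℂ} (h : F.IsHomogeneous d)
    (hn : ∀ q : Projectivization ℂ (Fin 3 → ℂ), IsSingularPoint F q → IsNodeOfCorank F 2 q) :
    {q : Projectivization ℂ (Fin 3 → ℂ) | IsSingularPoint F q}.Finite := by
  classical
  let g : (Fin 3 → ℂ) → Projectivization ℂ (Fin 3 → ℂ) := fun v =>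
    if hv : v ≠ 0 then Projectivization.mk ℂ v hv else
      Projectivization.mk ℂ (fun _ => 1) (fun h => one_ne_zero (congrFun h 0))
  apply ((Set.finite_iUnion (finite_chart h hn)).image g).subset
  intro q
  induction q using Projectivization.ind with
  | h v hv =>
  intro hq
  have hj := (sing_mk h v hv).1 hq
  obtain ⟨k, hk⟩ := Finite.exists_max (fun i => ‖v i‖)
  have hk0 : v k ≠ 0 := by
    intro h0
    apply hv
    ext i
    have := hk i
    rw [h0] at this
    simpa using this
  have hne : (v k)⁻¹ • v ≠ 0 := smul_ne_zero (inv_ne_zero hk0) hv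
  refine ⟨(v k)⁻¹ • v, Set.mem_iUnion.2 ⟨k, ?_, ?_, jac_smul h _ _ hj⟩, ?_⟩
  · simp [hk0]
  · rw [pi_norm_le_iff_of_nonneg zero_le_one]
    intro i
    simp only [Pi.smul_apply, smul_eq_mul, norm_mul, norm_inv]
    rw [inv_mul_le_iff₀ (norm_pos_iff.2 hk0)]
    simpa using hk i
  · simp only [g, dif_pos hne]
    exact (Projectivization.mk_eq_mk_iff' ℂ _ _ _ _).2 ⟨_, rfl⟩

lemma inv_grad_poly {n : ℕ} (M : Matrix (Fin n) (Fin n) ℂ) {F : MvPolynomial (Fin n) ℂ}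
    (h : aeval (fun i => ∑ j, C (M i j) * X j : Fin n → MvPolynomial (Fin n) ℂ) F = F)
    (i : Fin n) :
    pderiv i F = ∑ j, aeval (fun i => ∑ j, C (M i j) * X j : Fin n → MvPolynomial (Fin n) ℂ)
      (pderiv j F) * C (M j i) := by
  conv_lhs => rw [← h]
  rw [pderiv_aeval]
  refine Finset.sum_congr rfl fun j _ => ?_
  congr 1
  rw [map_sum, Finset.sum_eq_single i]
  · simp [Derivation.leibniz]
  · intro b _ hb; simp [Derivation.leibniz, hb]
  · simp

lemma eval_aeval_lin {n : ℕ} (M : Matrix (Fin n) (Fin n) ℂ) (F : MvPolynomial (Fin n) ℂ)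
    (v : Fin n → ℂ) :
    eval v (aeval (fun i => ∑ j, C (M i j) * X j : Fin n → MvPolynomial (Fin n) ℂ) F) =
      eval (M *ᵥ v) F := by
  induction F using MvPolynomial.induction_on with
  | C a => simp [algebraMap_eq]
  | add p q hp hq => simp only [map_add, hp, hq]
  | mul_X p k hp => simp only [map_mul, hp, aeval_X, eval_X]; simp [Matrix.mulVec, dotProduct]

lemma inv_jac {n : ℕ} (M : Matrix (Fin n) (Fin n) ℂ) {F : MvPolynomial (Fin n) ℂ}
    (h : aeval (fun i => ∑ j, C (M i j) * X j : Fin n → MvPolynomial (Fin n) ℂ) F = F)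
    (v : Fin n → ℂ) (hj : VanishingJacobianAt F (M *ᵥ v)) : VanishingJacobianAt F v := by
  intro i
  rw [inv_grad_poly M h i, map_sum]
  refine Finset.sum_eq_zero fun j _ => ?_
  rw [map_mul, eval_aeval_lin, hj j, zero_mul]

lemma inv_hess {n : ℕ} (M : Matrix (Fin n) (Fin n) ℂ) {F : MvPolynomial (Fin n) ℂ}
    (h : aeval (fun i => ∑ j, C (M i j) * X j : Fin n → MvPolynomial (Fin n) ℂ) F = F)
    (v : Fin n → ℂ) : hessianAt F v = Mᵀ * hessianAt F (M *ᵥ v) * M := by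
  ext k i
  simp only [hessianAt, Matrix.of_apply, Matrix.mul_apply, Matrix.transpose_apply]
  rw [inv_grad_poly M h i, map_sum, map_sum]
  refine Finset.sum_congr rfl fun j _ => ?_
  rw [Derivation.leibniz, pderiv_C, smul_zero, zero_add, smul_eq_mul, map_mul, eval_C, mul_comm,
    pderiv_aeval, map_sum]
  congr 1
  refine Finset.sum_congr rfl fun l _ => ?_
  rw [map_mul, eval_aeval_lin, mul_comm]
  congr 1
  rw [map_sum, Finset.sum_eq_single k]
  · simp [Derivation.leibniz]
  · intro b _ hb; simp [Derivation.leibniz, hb]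
  · simp

/-- Rotation by `η` in the coordinates `x ± iy`. -/
noncomputable def rotM (η : ℂ) : Matrix (Fin 4) (Fin 4) ℂ :=
  !![(η + η⁻¹) / 2, Complex.I * (η - η⁻¹) / 2, 0, 0;
     -(Complex.I * (η - η⁻¹) / 2), (η + η⁻¹) / 2, 0, 0;
     0, 0, 1, 0;
     0, 0, 0, 1]

lemma rotM_mulVec (η : ℂ) (v : Fin 4 → ℂ) : rotM η *ᵥ v =
    ![(η + η⁻¹) / 2 * v 0 + Complex.I * (η - η⁻¹) / 2 * v 1,
      -(Complex.I * (η - η⁻¹) / 2) * v 0 + (η + η⁻¹) / 2 * v 1, v 2, v 3] := by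
  ext i
  fin_cases i <;> simp [rotM, Matrix.mulVec, dotProduct, Fin.sum_univ_four]

lemma rotM_inv_mulVec {η : ℂ} (h : η ≠ 0) (v : Fin 4 → ℂ) :
    rotM η⁻¹ *ᵥ (rotM η *ᵥ v) = v := by
  have hI := Complex.I_sq
  rw [rotM_mulVec, rotM_mulVec]
  ext i
  fin_cases i <;> simp
  · field_simp
    linear_combination ((η^2-1)^2 * v 0) * hI
  · field_simp
    linear_combination ((η^2-1)^2 * v 1) * hI

lemma rotM_det {η : ℂ} (h : η ≠ 0) : IsUnit (rotM η).det := by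
  apply Matrix.isUnit_det_of_left_inverse (B := rotM η⁻¹)
  apply Matrix.ext_of_mulVec_single
  intro i
  rw [← Matrix.mulVec_mulVec, rotM_inv_mulVec h, Matrix.one_mulVec]

lemma rot_rank {η : ℂ} (h0 : η ≠ 0) {F : MvPolynomial (Fin 4) ℂ}
    (h : aeval (fun i => ∑ j, C (rotM η i j) * X j : Fin 4 → MvPolynomial (Fin 4) ℂ) F = F)
    (v : Fin 4 → ℂ) : (hessianAt F v).rank = (hessianAt F (rotM η *ᵥ v)).rank := by
  rw [inv_hess _ h v, Matrix.rank_mul_eq_left_of_isUnit_det _ _ (rotM_det h0),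
    Matrix.rank_mul_eq_right_of_isUnit_det]
  rw [Matrix.det_transpose]
  exact rotM_det h0

lemma pderiv_num (i : Fin 4) (k : ℕ) [k.AtLeastTwo] :
    pderiv i (OfNat.ofNat k : MvPolynomial (Fin 4) ℂ) = 0 := by
  have := pderiv_C (R := ℂ) (i := i) (a := (OfNat.ofNat k : ℂ))
  rwa [map_ofNat] at this

lemma T_formula {R : Type*} [CommRing R] (i x y : R) (hi : i ^ 2 = -1) :
    2 * (x * (x ^ 6 - 21 * x ^ 4 * y ^ 2 + 35 * x ^ 2 * y ^ 4 - 7 * y ^ 6)) =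
      (x + i * y) ^ 7 + (x - i * y) ^ 7 := by
  have h4 : i ^ 4 = 1 := by linear_combination (i ^ 2 - 1) * hi
  have h6 : i ^ 6 = -1 := by linear_combination i ^ 2 * h4 + hi
  linear_combination -42 * x ^ 5 * y ^ 2 * hi - 70 * x ^ 3 * y ^ 4 * h4 - 14 * x * y ^ 6 * h6

lemma T_inv {i e f x y A B : MvPolynomial (Fin 4) ℂ} (hi : i ^ 2 = -1)
    (he : e ^ 7 = 1) (hf : f ^ 7 = 1)
    (h1 : A + i * B = e * (x + i * y)) (h2 : A - i * B = f * (x - i * y)) :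
    A * (A ^ 6 - 21 * A ^ 4 * B ^ 2 + 35 * A ^ 2 * B ^ 4 - 7 * B ^ 6) =
    x * (x ^ 6 - 21 * x ^ 4 * y ^ 2 + 35 * x ^ 2 * y ^ 4 - 7 * y ^ 6) := by
  have h2' : (2 : MvPolynomial (Fin 4) ℂ) ≠ 0 := two_ne_zero
  apply mul_left_cancel₀ h2'
  rw [T_formula i A B hi, T_formula i x y hi, h1, h2, mul_pow, mul_pow, he, hf]
  ring

lemma S_inv (a₁ a₂ a₃ a₄ a₅ η : ℂ) (hη : η ^ 7 = 1) :
    aeval (fun i => ∑ j, C (rotM η i j) * X j : Fin 4 → MvPolynomial (Fin 4) ℂ)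
      (Psept - Usept a₁ a₂ a₃ a₄ a₅) = Psept - Usept a₁ a₂ a₃ a₄ a₅ := by
  have h0 : η ≠ 0 := by rintro rfl; simp at hη
  have hI : (C Complex.I : MvPolynomial (Fin 4) ℂ) ^ 2 = -1 := by
    rw [← C_pow, Complex.I_sq]; simp
  set A : MvPolynomial (Fin 4) ℂ := C ((η + η⁻¹) / 2) * X 0 + C (Complex.I * (η - η⁻¹) / 2) * X 1
    with hA
  set B : MvPolynomial (Fin 4) ℂ :=
    C (-(Complex.I * (η - η⁻¹) / 2)) * X 0 + C ((η + η⁻¹) / 2) * X 1 with hB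
  have hg : (fun i => ∑ j, C (rotM η i j) * X j : Fin 4 → MvPolynomial (Fin 4) ℂ) =
      ![A, B, X 2, X 3] := by
    ext1 i
    fin_cases i <;> simp [rotM, Fin.sum_univ_four, hA, hB]
  have hc1 : (C Complex.I * C (Complex.I * (η - η⁻¹) / 2) : MvPolynomial (Fin 4) ℂ) =
      C (-(η - η⁻¹) / 2) := by
    rw [← C_mul]; congr 1; linear_combination (η - η⁻¹) / 2 * Complex.I_sq
  have hc2 : (C ((η + η⁻¹) / 2) : MvPolynomial (Fin 4) ℂ) - C (-(η - η⁻¹) / 2) = C η := by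
    rw [← C_sub]; congr 1; ring
  have hc3 : (C ((η + η⁻¹) / 2) : MvPolynomial (Fin 4) ℂ) + C (-(η - η⁻¹) / 2) = C η⁻¹ := by
    rw [← C_add]; congr 1; ring
  have h1 : A + C Complex.I * B = C η * (X 0 + C Complex.I * X 1) := by
    rw [hA, hB, C_neg, ← hc2, ← hc1]
    linear_combination (C (Complex.I * (η - η⁻¹) / 2) * X 1) * hI
  have h2 : A - C Complex.I * B = C η⁻¹ * (X 0 - C Complex.I * X 1) := by
    rw [hA, hB, C_neg, ← hc3, ← hc1]
    linear_combination (C (Complex.I * (η - η⁻¹) / 2) * X 1) * hI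
  have hq : A ^ 2 + B ^ 2 = X 0 ^ 2 + X 1 ^ 2 := by
    have h3 : (C η * C η⁻¹ : MvPolynomial (Fin 4) ℂ) = 1 := by
      rw [← C_mul, mul_inv_cancel₀ h0]; simp
    have h4 : (A + C Complex.I * B) * (A - C Complex.I * B) =
      (X 0 + C Complex.I * X 1) * (X 0 - C Complex.I * X 1) := by
      rw [h1, h2]
      linear_combination ((X 0 + C Complex.I * X 1) * (X 0 - C Complex.I * X 1)) * h3
    linear_combination h4 + (B ^ 2 - X 1 ^ 2) * hI
  have hT := T_inv hI (by rw [← C_pow, hη]; simp) (by rw [← C_pow, inv_pow, hη]; simp) h1 h2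
  rw [hg]
  clear_value A B
  simp only [Psept, Usept, map_sub, map_add, map_mul, map_pow, aeval_X, map_ofNat, aeval_C,
    algebraMap_eq]
  simp only [Matrix.cons_val]
  rw [hq, hT]

lemma hnum (k : ℕ) [k.AtLeastTwo] :
    (OfNat.ofNat k : MvPolynomial (Fin 4) ℂ).IsHomogeneous 0 := by
  have := isHomogeneous_C (Fin 4) (OfNat.ofNat k : ℂ)
  rwa [map_ofNat] at this

lemma S_hom (a₁ a₂ a₃ a₄ a₅ : ℂ) : (Psept - Usept a₁ a₂ a₃ a₄ a₅).IsHomogeneous 7 := by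
  have hX : ∀ i : Fin 4, (X i : MvPolynomial (Fin 4) ℂ).IsHomogeneous 1 := isHomogeneous_X ℂ
  have hC : ∀ a : ℂ, (C a : MvPolynomial (Fin 4) ℂ).IsHomogeneous 0 := isHomogeneous_C _
  have hq : ((X 0) ^ 2 + (X 1) ^ 2 : MvPolynomial (Fin 4) ℂ).IsHomogeneous 2 :=
    ((hX 0).pow 2).add ((hX 1).pow 2)
  have hP : Psept.IsHomogeneous 7 := by
    refine IsHomogeneous.sub (IsHomogeneous.add ?_ ?_) ((hnum 64).mul ((hX 2).pow 7))
    · exact (hX 0).mul (((((hX 0).pow 6).sub (((hnum 21).mul ((hX 0).pow 4)).mul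
        ((hX 1).pow 2))).add (((hnum 35).mul ((hX 0).pow 2)).mul ((hX 1).pow 4))).sub
        ((hnum 7).mul ((hX 1).pow 6)))
    · exact ((hnum 7).mul (hX 2)).mul (((hq.pow 3).sub (((hnum 8).mul ((hX 2).pow 2)).mul
        (hq.pow 2))).add (((hnum 16).mul ((hX 2).pow 4)).mul hq))
  refine hP.sub ?_
  refine ((hX 2).add ((hC a₅).mul (hX 3))).mul (n := 3 * 2) (IsHomogeneous.pow ?_ 2)
  exact (((((hC a₁).mul ((hX 2).pow 3)).add (((hC a₂).mul ((hX 2).pow 2)).mul (hX 3))).add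
    (((hC a₃).mul (hX 2)).mul ((hX 3).pow 2))).add ((hC a₄).mul ((hX 3).pow 3))).add
    (((hX 2).add (hX 3)).mul hq)

lemma S_dy (a₁ a₂ a₃ a₄ a₅ : ℂ) (v : Fin 4 → ℂ) (hv : v 1 = 0) :
    eval v (pderiv 1 (Psept - Usept a₁ a₂ a₃ a₄ a₅)) = 0 := by
  simp [Psept, Usept, Derivation.leibniz, Derivation.leibniz_pow, pderiv_num _ 7, pderiv_num _ 8,
    pderiv_num _ 16, pderiv_num _ 21, pderiv_num _ 35, pderiv_num _ 64, pderiv_X, hv]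

lemma S_rot (a₁ a₂ a₃ a₄ a₅ : ℂ) (v : Fin 4 → ℂ) :
    v 1 * eval v (pderiv 0 (Psept - Usept a₁ a₂ a₃ a₄ a₅)) -
      v 0 * eval v (pderiv 1 (Psept - Usept a₁ a₂ a₃ a₄ a₅)) =
      7 * (7 * v 0 ^ 6 * v 1 - 35 * v 0 ^ 4 * v 1 ^ 3 + 21 * v 0 ^ 2 * v 1 ^ 5 - v 1 ^ 7) := by
  simp [Psept, Usept, Derivation.leibniz, Derivation.leibniz_pow, pderiv_num _ 7, pderiv_num _ 8,
    pderiv_num _ 16, pderiv_num _ 21, pderiv_num _ 35, pderiv_num _ 64, pderiv_X]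
  ring

/-- The inclusion of the plane `y = 0`. -/
def emb (w : Fin 3 → ℂ) : Fin 4 → ℂ := ![w 0, 0, w 1, w 2]

lemma Sy_jac (a₁ a₂ a₃ a₄ a₅ : ℂ) (w : Fin 3 → ℂ) :
    VanishingJacobianAt (aeval (![X 0, 0, X 1, X 2] : Fin 4 → MvPolynomial (Fin 3) ℂ)
      (Psept - Usept a₁ a₂ a₃ a₄ a₅)) w ↔
    VanishingJacobianAt (Psept - Usept a₁ a₂ a₃ a₄ a₅) (emb w) := by
  have he : ∀ F : MvPolynomial (Fin 4) ℂ,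
      eval w (aeval (![X 0, 0, X 1, X 2] : Fin 4 → MvPolynomial (Fin 3) ℂ) F) =
        eval (emb w) F := by
    intro F
    induction F using MvPolynomial.induction_on with
    | C a => simp [algebraMap_eq]
    | add p q hp hq => simp only [map_add, hp, hq]
    | mul_X p k hp =>
      simp only [map_mul, hp, aeval_X, eval_X]
      fin_cases k <;> simp [emb]
  have hy := S_dy a₁ a₂ a₃ a₄ a₅ (emb w) (by simp [emb])
  generalize Psept - Usept a₁ a₂ a₃ a₄ a₅ = S at hy ⊢
  have h : ∀ i, eval w (pderiv i (aeval (![X 0, 0, X 1, X 2] :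
      Fin 4 → MvPolynomial (Fin 3) ℂ) S)) =
      eval (emb w) (pderiv (![0, 2, 3] i) S) := by
    intro i
    rw [pderiv_aeval, map_sum]
    simp only [map_mul, he, Fin.sum_univ_four]
    fin_cases i <;> simp [pderiv_X]
  simp only [VanishingJacobianAt, h, Fin.forall_fin_succ]
  simp [hy]

lemma decomp (a₁ a₂ a₃ a₄ a₅ : ℂ) (v : Fin 4 → ℂ)
    (hj : VanishingJacobianAt (Psept - Usept a₁ a₂ a₃ a₄ a₅) v) :
    ∃ η : ℂ, η ^ 7 = 1 ∧ ∃ w, rotM η *ᵥ emb w = v := by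
  have hI := Complex.I_sq
  have h := S_rot a₁ a₂ a₃ a₄ a₅ v
  rw [hj 0, hj 1] at h
  have h7 : (v 0 + Complex.I * v 1) ^ 7 = (v 0 - Complex.I * v 1) ^ 7 := by
    have h3 : Complex.I ^ 3 = -Complex.I := by linear_combination Complex.I * hI
    have h5 : Complex.I ^ 5 = Complex.I := by linear_combination Complex.I ^ 2 * h3 - Complex.I * hI
    have h7 : Complex.I ^ 7 = -Complex.I := by linear_combination Complex.I ^ 2 * h5 + Complex.I * hI
    linear_combination (-2 / 7 * Complex.I) * h + 70 * v 0 ^ 4 * v 1 ^ 3 * h3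
      + 42 * v 0 ^ 2 * v 1 ^ 5 * h5 + 2 * v 1 ^ 7 * h7
  suffices ∃ η : ℂ, η ^ 7 = 1 ∧ (rotM η *ᵥ v) 1 = 0 by
    obtain ⟨η, hη, h0⟩ := this
    have hη0 : η ≠ 0 := by rintro rfl; simp at hη
    refine ⟨η⁻¹, by rw [inv_pow, hη, inv_one],
      ![(rotM η *ᵥ v) 0, (rotM η *ᵥ v) 2, (rotM η *ᵥ v) 3], ?_⟩
    conv_rhs => rw [← rotM_inv_mulVec hη0 v]
    congr 1
    ext i
    fin_cases i <;> simp [emb, h0]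
  by_cases hu : v 0 + Complex.I * v 1 = 0
  · have hu' : v 0 - Complex.I * v 1 = 0 := by
      rw [hu] at h7
      exact pow_eq_zero_iff (n := 7) (by norm_num) |>.1 (by rw [← h7]; simp)
    refine ⟨1, one_pow _, ?_⟩
    rw [rotM_mulVec]
    simp
    have : 2 * Complex.I * v 1 = 0 := by linear_combination hu - hu'
    simpa using this
  · have hu' : v 0 - Complex.I * v 1 ≠ 0 := by
      intro h0
      rw [h0] at h7
      exact hu (pow_eq_zero_iff (n := 7) (by norm_num) |>.1 (by rw [h7]; simp))
    set u := v 0 + Complex.I * v 1 with hud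
    set t := v 0 - Complex.I * v 1 with htd
    have hv0 : v 0 = (u + t) / 2 := by rw [hud, htd]; ring
    have hv1 : v 1 = -Complex.I * (u - t) / 2 := by
      rw [hud, htd]; linear_combination v 1 * hI
    set ζ := u / t with hζ
    have hz : ζ ^ 7 = 1 := by rw [hζ, div_pow, h7, div_self (pow_ne_zero _ hu')]
    have hu2 : u = ζ * t := by rw [hζ]; field_simp
    have hz0 : ζ ≠ 0 := div_ne_zero hu hu'
    refine ⟨ζ ^ 3, by rw [← pow_mul, mul_comm, pow_mul, hz, one_pow], ?_⟩
    rw [rotM_mulVec]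
    have hinv : (ζ ^ 3)⁻¹ = ζ ^ 4 := inv_eq_of_mul_eq_one_right (by rw [← pow_add, hz])
    simp only [Matrix.cons_val_one, Matrix.cons_val_zero]
    rw [hinv, hv0, hv1, hu2]
    linear_combination (0 : ℂ) * hz

/-- Rotated inclusion as a linear map. -/
noncomputable def Phil (η : ℂ) : (Fin 3 → ℂ) →ₗ[ℂ] (Fin 4 → ℂ) where
  toFun w := rotM η *ᵥ emb w
  map_add' u v := by
    rw [← Matrix.mulVec_add]; congr 1; ext i; fin_cases i <;> simp [emb]
  map_smul' c v := by
    rw [RingHom.id_apply, ← Matrix.mulVec_smul]; congr 1; ext i; fin_cases i <;> simp [emb]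

lemma Phil_apply (η : ℂ) (w : Fin 3 → ℂ) : Phil η w =
    ![(η + η⁻¹) / 2 * w 0, -(Complex.I * (η - η⁻¹) / 2) * w 0, w 1, w 2] := by
  change rotM η *ᵥ emb w = _
  rw [rotM_mulVec]; simp [emb]

lemma Phil_eq {η θ : ℂ} {v w : Fin 3 → ℂ} (h : Phil η v = Phil θ w) :
    η * v 0 = θ * w 0 ∧ η⁻¹ * v 0 = θ⁻¹ * w 0 ∧ v 1 = w 1 ∧ v 2 = w 2 := by
  rw [Phil_apply, Phil_apply] at h
  have h0 := congrFun h 0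
  have h1 := congrFun h 1
  have h2 := congrFun h 2
  have h3 := congrFun h 3
  simp only [Matrix.cons_val] at h0 h1 h2 h3
  have hI := Complex.I_sq
  refine ⟨?_, ?_, h2, h3⟩
  · linear_combination h0 + Complex.I * h1 +
      ((η - η⁻¹) / 2 * v 0 - (θ - θ⁻¹) / 2 * w 0) * hI
  · linear_combination h0 - Complex.I * h1 -
      ((η - η⁻¹) / 2 * v 0 - (θ - θ⁻¹) / 2 * w 0) * hI

lemma Phil_inj {η : ℂ} (h : η ≠ 0) : Function.Injective (Phil η) := by
  intro v w hvw
  obtain ⟨h0, -, h1, h2⟩ := Phil_eq hvw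
  ext i
  fin_cases i
  · exact mul_left_cancel₀ h h0
  · exact h1
  · exact h2

/-- Rotated inclusion at the level of projective spaces. -/
noncomputable def Phi (η : rootsOfUnity 7 ℂ) :
    Projectivization ℂ (Fin 3 → ℂ) → Projectivization ℂ (Fin 4 → ℂ) :=
  Projectivization.map (Phil ((η : ℂˣ) : ℂ)) (Phil_inj (Units.ne_zero _))

lemma axis_mk (v : Fin 3 → ℂ) (hv : v ≠ 0) :
    LiesOnAxisX0 (Projectivization.mk ℂ v hv) ↔ v 0 = 0 := by
  constructor
  · rintro ⟨w, hw, he, h0⟩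
    obtain ⟨c, hc⟩ := (Projectivization.mk_eq_mk_iff' ℂ v w hv hw).1 he.symm
    rw [← hc]; simp [h0]
  · exact fun h => ⟨v, hv, rfl, h⟩

lemma root_pow (η : rootsOfUnity 7 ℂ) : ((η : ℂˣ) : ℂ) ^ 7 = 1 := by
  have := (mem_rootsOfUnity' 7 (η : ℂˣ)).1 η.2
  exact this

lemma Phi_eq {η θ : rootsOfUnity 7 ℂ} {p q : Projectivization ℂ (Fin 3 → ℂ)}
    (h : Phi η p = Phi θ q) :
    (LiesOnAxisX0 p → LiesOnAxisX0 q) ∧ (¬ LiesOnAxisX0 p → η = θ ∧ p = q) := by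
  induction p using Projectivization.ind with
  | h v hv =>
  induction q using Projectivization.ind with
  | h w hw =>
  rw [axis_mk, axis_mk]
  have hη := root_pow η
  have hθ := root_pow θ
  have hη0 : ((η : ℂˣ) : ℂ) ≠ 0 := Units.ne_zero _
  have hθ0 : ((θ : ℂˣ) : ℂ) ≠ 0 := Units.ne_zero _
  rw [Phi, Phi, Projectivization.map_mk, Projectivization.map_mk,
    Projectivization.mk_eq_mk_iff'] at h
  obtain ⟨a, ha⟩ := h
  rw [← map_smul] at ha
  have hwa : a ≠ 0 := by
    rintro rfl
    rw [zero_smul, map_zero] at ha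
    exact hv (Phil_inj hη0 (by rw [← ha, map_zero]))
  obtain ⟨h0, h0', h1, h2⟩ := Phil_eq ha
  simp only [Pi.smul_apply, smul_eq_mul] at h0 h0' h1 h2
  refine ⟨fun hz => ?_, fun hz => ?_⟩
  · rw [hz, mul_zero] at h0
    simpa [hwa] using h0
  · have hsq : ((θ : ℂˣ) : ℂ) ^ 2 = ((η : ℂˣ) : ℂ) ^ 2 := by
      apply mul_right_cancel₀ hz
      have hA : a * w 0 = ((θ : ℂˣ) : ℂ) * (((η : ℂˣ) : ℂ)⁻¹ * v 0) := by
        rw [← h0', ← mul_assoc, mul_inv_cancel₀ hθ0, one_mul]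
      rw [hA] at h0
      field_simp at h0
      linear_combination (v 0) * h0
    have heq : ((η : ℂˣ) : ℂ) = ((θ : ℂˣ) : ℂ) := by
      linear_combination (-((η : ℂˣ) : ℂ)) * hη + ((θ : ℂˣ) : ℂ) * hθ -
        (((θ : ℂˣ) : ℂ) ^ 6 + ((θ : ℂˣ) : ℂ) ^ 4 * ((η : ℂˣ) : ℂ) ^ 2 +
          ((θ : ℂˣ) : ℂ) ^ 2 * ((η : ℂˣ) : ℂ) ^ 4 + ((η : ℂˣ) : ℂ) ^ 6) * hsq
    refine ⟨Subtype.ext (Units.ext heq), ?_⟩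
    rw [Projectivization.mk_eq_mk_iff']
    refine ⟨a, ?_⟩
    ext i
    fin_cases i
    · rw [← heq] at h0
      exact mul_left_cancel₀ hη0 h0
    · exact h1
    · exact h2

lemma Phi_axis (η θ : rootsOfUnity 7 ℂ) {p : Projectivization ℂ (Fin 3 → ℂ)}
    (h : LiesOnAxisX0 p) : Phi η p = Phi θ p := by
  induction p using Projectivization.ind with
  | h v hv =>
  rw [axis_mk] at h
  rw [Phi, Phi, Projectivization.map_mk, Projectivization.map_mk]
  congr 1
  rw [Phil_apply, Phil_apply, h]
  simp

theorem dihedral_symmetry_lemma (a₁ a₂ a₃ a₄ a₅ : ℂ)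
    (S : MvPolynomial (Fin 4) ℂ) (hS : S = Psept - Usept a₁ a₂ a₃ a₄ a₅)
    (Sy : MvPolynomial (Fin 3) ℂ)
    (hSy : Sy = aeval (![X 0, 0, X 1, X 2] : Fin 4 → MvPolynomial (Fin 3) ℂ) S)
    (h₁ : eval ![1, Complex.I, 0, 0] S ≠ 0)
    (h₂ : ∀ p : Projectivization ℂ (Fin 4 → ℂ),
      IsSingularPoint S p → LiesInPlaneY0 p → IsNodeOfCorank S 3 p) :
    (∀ p : Projectivization ℂ (Fin 4 → ℂ),
        IsSingularPoint S p → IsNodeOfCorank S 3 p) ∧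
      ∀ n nxy : ℕ,
        {q : Projectivization ℂ (Fin 3 → ℂ) | IsSingularPoint Sy q}.ncard = n →
        (∀ q : Projectivization ℂ (Fin 3 → ℂ),
          IsSingularPoint Sy q → IsNodeOfCorank Sy 2 q) →
        {q : Projectivization ℂ (Fin 3 → ℂ) |
            IsSingularPoint Sy q ∧ LiesOnAxisX0 q}.ncard = nxy →
        {p : Projectivization ℂ (Fin 4 → ℂ) | IsSingularPoint S p}.ncard
            = nxy + 7 * (n - nxy) ∧
          ∀ p : Projectivization ℂ (Fin 4 → ℂ),
            IsSingularPoint S p → IsNodeOfCorank S 3 p := by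
  have hhom : S.IsHomogeneous 7 := hS ▸ S_hom a₁ a₂ a₃ a₄ a₅
  have hhomy : Sy.IsHomogeneous 7 := by
    rw [hSy]
    have := hhom.aeval (![X 0, 0, X 1, X 2] : Fin 4 → MvPolynomial (Fin 3) ℂ) (n := 1) (by
      intro i
      fin_cases i
      · exact isHomogeneous_X _ _
      · exact isHomogeneous_zero _ _ _
      · exact isHomogeneous_X _ _
      · exact isHomogeneous_X _ _)
    simpa using this
  have hinv : ∀ η : ℂ, η ^ 7 = 1 →
      aeval (fun i => ∑ j, C (rotM η i j) * X j : Fin 4 → MvPolynomial (Fin 4) ℂ) S = S := by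
    intro η hη; rw [hS]; exact S_inv a₁ a₂ a₃ a₄ a₅ η hη
  have hjac : ∀ w, VanishingJacobianAt Sy w ↔ VanishingJacobianAt S (emb w) := by
    intro w; rw [hSy, hS]; exact Sy_jac a₁ a₂ a₃ a₄ a₅ w
  have hdec : ∀ v, VanishingJacobianAt S v → ∃ η : ℂ, η ^ 7 = 1 ∧ ∃ w, rotM η *ᵥ emb w = v := by
    intro v; rw [hS]; exact decomp a₁ a₂ a₃ a₄ a₅ v
  have hrot : ∀ η : ℂ, η ^ 7 = 1 → ∀ v,
      VanishingJacobianAt S (rotM η *ᵥ v) ↔ VanishingJacobianAt S v := by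
    intro η hη v
    have hη0 : η ≠ 0 := by rintro rfl; simp at hη
    refine ⟨inv_jac _ (hinv η hη) v, fun h => ?_⟩
    apply inv_jac (rotM η⁻¹) (hinv _ (by rw [inv_pow, hη, inv_one]))
    rwa [rotM_inv_mulVec hη0]
  have part1 : ∀ p : Projectivization ℂ (Fin 4 → ℂ),
        IsSingularPoint S p → IsNodeOfCorank S 3 p := by
    intro p
    induction p using Projectivization.ind with
    | h v hv =>
    intro hs
    rw [sing_mk hhom] at hs
    obtain ⟨η, hη, w, rfl⟩ := hdec v hs
    have hη0 : η ≠ 0 := by rintro rfl; simp at hη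
    have hw : emb w ≠ 0 := by
      intro h; apply hv; rw [h, Matrix.mulVec_zero]
    have hs' := (hrot η hη _).1 hs
    have hnode := h₂ (Projectivization.mk ℂ (emb w) hw) ((sing_mk hhom _ _).2 hs')
      ⟨emb w, hw, rfl, by simp [emb]⟩
    rw [node_mk hhom] at hnode ⊢
    exact ⟨hs, by rw [← rot_rank hη0 (hinv η hη)]; exact hnode.2⟩
  refine ⟨part1, fun n nxy hn hnode hnxy => ⟨?_, part1⟩⟩
  set Q := {q : Projectivization ℂ (Fin 3 → ℂ) | IsSingularPoint Sy q} with hQ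
  set Q0 := {q : Projectivization ℂ (Fin 3 → ℂ) | IsSingularPoint Sy q ∧ LiesOnAxisX0 q} with hQ0
  have hfin : Q.Finite := finite_sing hhomy hnode
  have hsub : Q0 ⊆ Q := fun q hq => hq.1
  have hfin0 : Q0.Finite := hfin.subset hsub
  have hPhi : ∀ η q, IsSingularPoint S (Phi η q) ↔ IsSingularPoint Sy q := by
    intro η q
    induction q using Projectivization.ind with
    | h v hv =>
    rw [Phi, Projectivization.map_mk, sing_mk hhom, sing_mk hhomy, hjac]
    exact hrot _ (root_pow η) (emb v)
  have hset : {p : Projectivization ℂ (Fin 4 → ℂ) | IsSingularPoint S p} =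
      Phi 1 '' Q0 ∪ (fun x : rootsOfUnity 7 ℂ × Projectivization ℂ (Fin 3 → ℂ) =>
        Phi x.1 x.2) '' (Set.univ ×ˢ (Q \ Q0)) := by
    apply Set.Subset.antisymm
    · intro p
      induction p using Projectivization.ind with
      | h v hv =>
      intro hs
      have hs' := (sing_mk hhom v hv).1 hs
      obtain ⟨η, hη, w, rfl⟩ := hdec v hs'
      have hw : w ≠ 0 := by
        rintro rfl; exact hv (map_zero (Phil η))
      have hη0 : η ≠ 0 := by rintro rfl; simp at hη
      let η' : rootsOfUnity 7 ℂ := ⟨Units.mk0 η hη0, (mem_rootsOfUnity' 7 _).2 hη⟩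
      have hp : Phi η' (Projectivization.mk ℂ w hw) = Projectivization.mk ℂ (rotM η *ᵥ emb w) hv :=
        Projectivization.map_mk _ _ _ _
      rw [← hp] at hs ⊢
      have hq := (hPhi _ _).1 hs
      by_cases hax : LiesOnAxisX0 (Projectivization.mk ℂ w hw)
      · exact Or.inl ⟨_, ⟨hq, hax⟩, Phi_axis _ _ hax⟩
      · exact Or.inr ⟨(η', Projectivization.mk ℂ w hw), ⟨trivial, hq, fun h => hax h.2⟩, rfl⟩
    · rintro p (⟨q, hq, rfl⟩ | ⟨⟨η, q⟩, ⟨-, hq⟩, rfl⟩)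
      · exact (hPhi _ _).2 hq.1
      · exact (hPhi _ _).2 hq.1
  have hna : ∀ q ∈ Q \ Q0, ¬ LiesOnAxisX0 q := fun q hq h => hq.2 ⟨hq.1, h⟩
  have hfin1 : (Set.univ ×ˢ (Q \ Q0) :
      Set (rootsOfUnity 7 ℂ × Projectivization ℂ (Fin 3 → ℂ))).Finite :=
    Set.finite_univ.prod (hfin.subset Set.sdiff_subset)
  rw [hset, Set.ncard_union_eq _ (hfin0.image _) (hfin1.image _),
    Set.InjOn.ncard_image, Set.InjOn.ncard_image, Set.ncard_prod, Set.ncard_univ,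
    Complex.card_rootsOfUnity, Set.ncard_sdiff hsub hfin0, hn, hnxy]
  · rintro ⟨η, p⟩ ⟨-, hp⟩ ⟨θ, q⟩ - h
    obtain ⟨h1, h2⟩ := (Phi_eq h).2 (hna _ hp)
    exact Prod.ext h1 h2
  · exact (Projectivization.map_injective _ _).injOn
  · rw [Set.disjoint_left]
    rintro _ ⟨q, hq, rfl⟩ ⟨⟨η, p⟩, ⟨-, hp⟩, h⟩
    exact hna _ hp ((Phi_eq h.symm).1 hq.2)
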